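/- Let ℓ ≥ 1 and N > 2ℓ+2, with periodic boundary conditions or special boundary conditions s = (c₁, c_N), and Ñ = N − (ℓ+2). The map G♯ sending the class of a state ψ' ∈ ker Q̃ in the cohomology H_{Q̃}(V_Ñ) to the class of G ψ' in the two-step cohomology H₂₁ is well defined (it sends Q̃-cocycles to cocycles and Q̃-coboundaries to coboundaries of the two-step complex) and is a linear isomorphism; graded by fermion number, it identifies H_{Q̃}^f(V_Ñ) with H₂₁^{f+ℓ} for every f. -/

import Mathlib

attribute [local instance 10] Classical.propDecidable

noncomputable section

/-- A configuration of `N` sites: `true` = occupied, `false` = empty. -/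
abbrev Config (N : ℕ) := Fin N → Bool

/-- Extension of a configuration to all of `ℕ`, by empty sites outside the chain. -/
def extc {N : ℕ} (σ : Config N) (t : ℕ) : Bool :=
  if h : t < N then σ ⟨t, h⟩ else false

/-- The fermion number: the number of occupied sites. -/
def fermions {N : ℕ} (σ : Config N) : ℕ :=
  (Finset.univ.filter fun i => σ i = true).card

/-- Allowed configurations of the open chain of `N` sites with exclusion parameter `ℓ`
and special boundary conditions `(c₁, cN)`: no cluster is longer than `ℓ`, the cluster
containing the first site (if occupied) has length at most `c₁`, and the cluster
containing the last site (if occupied) has length at most `cN`. -/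
def OpenOK (N ℓ c₁ cN : ℕ) (σ : Config N) : Prop :=
  (∀ a : ℕ, ¬ ∀ k ≤ ℓ, extc σ (a + k) = true) ∧
  (¬ (c₁ + 1 ≤ N ∧ ∀ k ≤ c₁, extc σ k = true)) ∧
  (¬ (cN + 1 ≤ N ∧ ∀ k ≤ cN, extc σ (N - 1 - k) = true))

/-- Cyclic shift of a site of the closed chain by `k` steps. -/
def cyc {N : ℕ} (i : Fin N) (k : ℕ) : Fin N :=
  ⟨(i.1 + k) % N, Nat.mod_lt _ i.pos⟩

/-- Allowed configurations of the closed chain of `N` sites with periodic boundary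
conditions: the chain is not fully occupied and no maximal cyclic run of occupied
sites is longer than `ℓ`. -/
def PerOK (N ℓ : ℕ) (σ : Config N) : Prop :=
  ∀ i : Fin N, ∃ k ≤ ℓ, σ (cyc i k) = false

/-- The fermionic sign `(-1)^{#{j < i : σ j = 1}}`. -/
def sgn {N : ℕ} (σ : Config N) (i : Fin N) : ℂ :=
  (-1 : ℂ) ^ ((Finset.univ.filter fun j => j < i ∧ σ j = true).card)

/-- The Hilbert space `V_N`: complex functions on allowed configurations. -/
abbrev AState (N : ℕ) (OK : Config N → Prop) := {σ : Config N // OK σ} → ℂ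

/-- Matrix of the supercharge with amplitudes `A`, with particle insertion
restricted to the sublattice `S`: the entry `(τ, σ)` is the amplitude (with fermionic
sign) for obtaining `τ` from `σ` by occupying an empty site of `S`. -/
def QmatA (N : ℕ) (OK : Config N → Prop) (S : Fin N → Prop)
    (A : Config N → Fin N → ℂ) :
    Matrix {σ : Config N // OK σ} {σ : Config N // OK σ} ℂ := fun τ σ =>
  ∑ i : Fin N,
    if S i ∧ σ.1 i = false ∧ τ.1 = Function.update σ.1 i true
    then A σ.1 i * sgn σ.1 i else 0

/-- The supercharge with amplitudes `A` restricted to the sublattice `S`, as a linear map. -/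
def QopA (N : ℕ) (OK : Config N → Prop) (S : Fin N → Prop)
    (A : Config N → Fin N → ℂ) : AState N OK →ₗ[ℂ] AState N OK :=
  (QmatA N OK S A).mulVecLin

/-- The unit-coupling supercharge restricted to the sublattice `S`. -/
def Qop (N : ℕ) (OK : Config N → Prop) (S : Fin N → Prop) :
    AState N OK →ₗ[ℂ] AState N OK :=
  QopA N OK S fun _ _ => 1

/-- The subspace `V_{N,f}` of states supported on configurations with fermion number `f`. -/
def gradeV (N : ℕ) (OK : Config N → Prop) (f : ℕ) :
    Submodule ℂ (AState N OK) where
  carrier := {ψ | ∀ σ, fermions σ.1 ≠ f → ψ σ = 0}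
  add_mem' := by
    intro a b ha hb σ h
    show a σ + b σ = 0
    rw [ha σ h, hb σ h, add_zero]
  zero_mem' := by intro σ h; rfl
  smul_mem' := by
    intro c a ha σ h
    show c * a σ = 0
    rw [ha σ h, mul_zero]

/-- The cocycles at gradeV `f`: `ker Q ∩ V_{N,f}` (for the supercharge restricted to `S`). -/
def cocycles (N : ℕ) (OK : Config N → Prop) (S : Fin N → Prop) (f : ℕ) :
    Submodule ℂ (AState N OK) :=
  LinearMap.ker (Qop N OK S) ⊓ gradeV N OK f

/-- The coboundaries at gradeV `f`: `Q (V_{N,f-1})` (for the supercharge restricted to `S`). -/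
def cobounds (N : ℕ) (OK : Config N → Prop) (S : Fin N → Prop) (f : ℕ) :
    Submodule ℂ (AState N OK) :=
  (gradeV N OK (f - 1)).map (Qop N OK S)

/-- The cohomology `H_Q^f = ker (Q : V_{N,f} → V_{N,f+1}) / Q (V_{N,f-1})`. -/
abbrev CohSpace (N : ℕ) (OK : Config N → Prop) (S : Fin N → Prop) (f : ℕ) :=
  cocycles N OK S f ⧸ ((cobounds N OK S f).comap (cocycles N OK S f).subtype)

/-- The dimension of `H_Q^f`. -/
def cohDim (N : ℕ) (OK : Config N → Prop) (S : Fin N → Prop) (f : ℕ) : ℕ :=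
  Module.finrank ℂ (CohSpace N OK S f)

/-- The cohomology class represented by a cocycle. -/
def cohClass (N : ℕ) (OK : Config N → Prop) (S : Fin N → Prop) (f : ℕ)
    (ψ : AState N OK) (h : ψ ∈ cocycles N OK S f) : CohSpace N OK S f :=
  Submodule.Quotient.mk ⟨ψ, h⟩

/-- The first sublattice `S₁ = {1, …, ℓ+2}` (the first `ℓ+2` sites). -/
def S1 (N ℓ : ℕ) : Fin N → Prop := fun i => i.1 < ℓ + 2

/-- The second sublattice `S₂ = {ℓ+3, …, N}` (the remaining sites). -/
def S2 (N ℓ : ℕ) : Fin N → Prop := fun i => ℓ + 2 ≤ i.1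

/-- The configuration `χ σ'`: the `(ℓ+2)`-site configuration `χ = 0 1…1 0`
followed by the `Ñ`-site configuration `σ'`. -/
def glue (ℓ Nt : ℕ) (σ : Config Nt) : Config (Nt + (ℓ + 2)) := fun i =>
  if h : i.1 < ℓ + 2 then decide (1 ≤ i.1 ∧ i.1 ≤ ℓ)
  else σ ⟨i.1 - (ℓ + 2), by have h2 := i.isLt; omega⟩

/-- Matrix of the map `G : V_Ñ → V_N`, `e_{σ'} ↦ e_{χ σ'}`. -/
def Gmat (ℓ Nt : ℕ) (OKN : Config (Nt + (ℓ + 2)) → Prop) (OKt : Config Nt → Prop) :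
    Matrix {σ : Config (Nt + (ℓ + 2)) // OKN σ} {σ : Config Nt // OKt σ} ℂ :=
  fun τ σ => if τ.1 = glue ℓ Nt σ.1 then 1 else 0

/-- The linear map `G : V_Ñ → V_N` sending `e_{σ'}` to `e_{χ σ'}`. -/
def Gop (ℓ Nt : ℕ) (OKN : Config (Nt + (ℓ + 2)) → Prop) (OKt : Config Nt → Prop) :
    AState Nt OKt →ₗ[ℂ] AState (Nt + (ℓ + 2)) OKN :=
  (Gmat ℓ Nt OKN OKt).mulVecLin

/-- Cocycles of the two-step complex at gradeV `f`: states `ψ ∈ V_{N,f}` with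
`Q₁ ψ = 0` and `Q₂ ψ ∈ im Q₁`. -/
def K21 (N : ℕ) (OK : Config N → Prop) (ℓ f : ℕ) : Submodule ℂ (AState N OK) :=
  LinearMap.ker (Qop N OK (S1 N ℓ)) ⊓ gradeV N OK f ⊓
    (LinearMap.range (Qop N OK (S1 N ℓ))).comap (Qop N OK (S2 N ℓ))

/-- Coboundaries of the two-step complex at gradeV `f`: states of the form
`Q₂ α + Q₁ β` with `Q₁ α = 0`, of fermion number `f`. -/
def B21 (N : ℕ) (OK : Config N → Prop) (ℓ f : ℕ) : Submodule ℂ (AState N OK) :=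
  ((LinearMap.ker (Qop N OK (S1 N ℓ))).map (Qop N OK (S2 N ℓ)) ⊔
      LinearMap.range (Qop N OK (S1 N ℓ))) ⊓ gradeV N OK f

/-- The two-step cohomology `H₂₁ = H_{Q₂}(H_{Q₁})` at gradeV `f`. -/
abbrev H21 (N : ℕ) (OK : Config N → Prop) (ℓ f : ℕ) :=
  K21 N OK ℓ f ⧸ ((B21 N OK ℓ f).comap (K21 N OK ℓ f).subtype)

/-- The class in the two-step cohomology represented by a cocycle. -/
def h21Class (N : ℕ) (OK : Config N → Prop) (ℓ f : ℕ)
    (ψ : AState N OK) (h : ψ ∈ K21 N OK ℓ f) : H21 N OK ℓ f :=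
  Submodule.Quotient.mk ⟨ψ, h⟩

section Fermions

variable {N : ℕ}

lemma sgn_update (τ : Config N) (i j : Fin N) (b : Bool) :
    sgn (Function.update τ j b) i = if j < i ∧ τ j ≠ b then -sgn τ i else sgn τ i := by
  have key : ∀ σ : Config N, sgn σ i = (if j < i ∧ σ j = true then -1 else 1) *
      ∏ k ∈ Finset.univ.erase j, if k < i ∧ σ k = true then (-1 : ℂ) else 1 := by
    intro σ
    rw [Finset.mul_prod_erase Finset.univ
      (fun k => if k < i ∧ σ k = true then (-1 : ℂ) else 1) (Finset.mem_univ j)]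
    simp [sgn, Finset.prod_ite]
  have h : (∏ k ∈ Finset.univ.erase j,
        if k < i ∧ Function.update τ j b k = true then (-1 : ℂ) else 1) =
      ∏ k ∈ Finset.univ.erase j, if k < i ∧ τ k = true then (-1 : ℂ) else 1 :=
    Finset.prod_congr rfl fun k hk => by
      rw [Function.update_of_ne (Finset.ne_of_mem_erase hk)]
  rw [key (Function.update τ j b), key τ, h, Function.update_self]
  by_cases hj : j < i <;> cases hb : b <;> cases ht : τ j <;> simp [hj]

lemma sgn_mul_self (τ : Config N) (i : Fin N) : sgn τ i * sgn τ i = 1 := by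
  rw [sgn, ← mul_pow]; simp

lemma sgn_ne_zero (τ : Config N) (i : Fin N) : sgn τ i ≠ 0 := by
  simp [sgn]

/-- Insertion of a particle at site `i`, without any exclusion rule. -/
def cre (i : Fin N) : (Config N → ℂ) →ₗ[ℂ] (Config N → ℂ) where
  toFun ψ τ := if τ i = true then sgn τ i * ψ (Function.update τ i false) else 0
  map_add' ψ φ := by
    ext τ; by_cases h : τ i = true <;> simp [h, mul_add]
  map_smul' c ψ := by
    ext τ; by_cases h : τ i = true <;> simp [h, mul_left_comm]

/-- Removal of a particle at site `i`. -/
def ann (i : Fin N) : (Config N → ℂ) →ₗ[ℂ] (Config N → ℂ) where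
  toFun ψ τ := if τ i = true then 0 else sgn τ i * ψ (Function.update τ i true)
  map_add' ψ φ := by
    ext τ; by_cases h : τ i = true <;> simp [h, mul_add]
  map_smul' c ψ := by
    ext τ; by_cases h : τ i = true <;> simp [h, mul_left_comm]

lemma cre_apply (i : Fin N) (ψ : Config N → ℂ) (τ : Config N) :
    cre i ψ τ = if τ i = true then sgn τ i * ψ (Function.update τ i false) else 0 := rfl

lemma ann_apply (i : Fin N) (ψ : Config N → ℂ) (τ : Config N) :
    ann i ψ τ = if τ i = true then 0 else sgn τ i * ψ (Function.update τ i true) := rfl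

lemma cre_cre_add (i j : Fin N) (ψ : Config N → ℂ) :
    cre i (cre j ψ) + cre j (cre i ψ) = 0 := by
  ext τ
  rcases eq_or_ne i j with rfl | hij
  · simp [cre_apply]
  · simp only [Pi.add_apply, Pi.zero_apply, cre_apply, Function.update_of_ne hij,
      Function.update_of_ne hij.symm, sgn_update, Function.update_comm hij]
    rcases lt_or_gt_of_ne hij with h | h <;>
      cases hi : τ i <;> cases hj : τ j <;> simp [h, h.not_gt] <;> ring

lemma ann_cre_add (i j : Fin N) (ψ : Config N → ℂ) :
    ann i (cre j ψ) + cre j (ann i ψ) = if i = j then ψ else 0 := by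
  ext τ
  rcases eq_or_ne i j with rfl | hij
  · cases hi : τ i
    · have : Function.update τ i false = τ := by rw [← hi, Function.update_eq_self]
      simp [cre_apply, ann_apply, sgn_update, hi, ← mul_assoc, sgn_mul_self, this]
    · have : Function.update τ i true = τ := by rw [← hi, Function.update_eq_self]
      simp [cre_apply, ann_apply, sgn_update, hi, ← mul_assoc, sgn_mul_self, this]
  · simp only [Pi.add_apply, cre_apply, ann_apply, Function.update_of_ne hij,
      Function.update_of_ne hij.symm, sgn_update, Function.update_comm hij, if_neg hij,
      Pi.zero_apply]
    rcases lt_or_gt_of_ne hij with h | h <;>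
      cases hi : τ i <;> cases hj : τ j <;> simp [h, h.not_gt] <;> ring

/-- The supercharge on the sublattice `S` without any exclusion rule. -/
def free (S : Fin N → Prop) : (Config N → ℂ) →ₗ[ℂ] (Config N → ℂ) :=
  ∑ i with S i, cre i

lemma free_apply (S : Fin N → Prop) (ψ : Config N → ℂ) :
    free S ψ = ∑ i with S i, cre i ψ := by
  simp [free]

lemma free_apply_apply (S : Fin N → Prop) (ψ : Config N → ℂ) (τ : Config N) :
    free S ψ τ = ∑ i with S i, cre i ψ τ := by
  simp [free]

lemma free_anticomm (S T : Fin N → Prop) (ψ : Config N → ℂ) :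
    free S (free T ψ) + free T (free S ψ) = 0 := by
  simp only [free_apply, map_sum]
  rw [Finset.sum_comm, ← Finset.sum_add_distrib]
  refine Finset.sum_eq_zero fun i _ => ?_
  rw [← Finset.sum_add_distrib]
  exact Finset.sum_eq_zero fun j _ => cre_cre_add _ _ _

lemma free_free (S : Fin N → Prop) (ψ : Config N → ℂ) : free S (free S ψ) = 0 :=
  self_eq_neg.mp (eq_neg_of_add_eq_zero_left (free_anticomm S S ψ))

lemma ann_free_add {S : Fin N → Prop} {i : Fin N} (hi : S i) (ψ : Config N → ℂ) :
    ann i (free S ψ) + free S (ann i ψ) = ψ := by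
  simp only [free_apply, map_sum]
  rw [← Finset.sum_add_distrib]
  simp only [ann_cre_add]
  rw [Finset.sum_ite_eq]
  simp [hi]

lemma free_ann {S : Fin N → Prop} {i : Fin N} (hi : S i) {ψ : Config N → ℂ}
    (h : free S ψ = 0) : free S (ann i ψ) = ψ := by
  simpa [h] using ann_free_add hi ψ

lemma free_support {S : Fin N → Prop} {P : Config N → Prop} {ψ : Config N → ℂ}
    (hP : ∀ τ i, S i → P (Function.update τ i false) → P τ)
    (hψ : ∀ τ, ¬ P τ → ψ τ = 0) (τ : Config N) (h : ¬ P τ) : free S ψ τ = 0 := by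
  rw [free_apply_apply]
  refine Finset.sum_eq_zero fun i hi => ?_
  rw [cre_apply, hψ _ fun h' => h (hP τ i (by simpa using hi) h')]
  simp

lemma free_eq_zero {S : Fin N → Prop} {ψ : Config N → ℂ} {τ : Config N}
    (h : ∀ i, S i → τ i = true → ψ (Function.update τ i false) = 0) : free S ψ τ = 0 := by
  rw [free_apply_apply]
  refine Finset.sum_eq_zero fun i hi => ?_
  rw [cre_apply]
  split_ifs with h'
  · rw [h i (by simpa using hi) h', mul_zero]
  · rfl

lemma ann_support {i : Fin N} {P : Config N → Prop} {ψ : Config N → ℂ}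
    (hP : ∀ τ, P (Function.update τ i true) → P τ)
    (hψ : ∀ τ, ¬ P τ → ψ τ = 0) (τ : Config N) (h : ¬ P τ) : ann i ψ τ = 0 := by
  rw [ann_apply, hψ _ fun h' => h (hP τ h')]
  simp

/-- Extension of a state by zero to all configurations. -/
def extendZero {OK : Config N → Prop} (ψ : AState N OK) (τ : Config N) : ℂ :=
  if h : OK τ then ψ ⟨τ, h⟩ else 0

lemma Qop_apply {OK : Config N → Prop}
    (hOK : ∀ τ i, OK τ → OK (Function.update τ i false)) (S : Fin N → Prop)
    (ψ : AState N OK) (τ : {σ // OK σ}) :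
    Qop N OK S ψ τ = free S (extendZero ψ) τ.1 := by
  rw [free_apply_apply, Finset.sum_filter]
  simp only [Qop, QopA, Matrix.mulVecLin_apply, Matrix.mulVec, dotProduct, QmatA,
    Finset.sum_mul]
  rw [Finset.sum_comm]
  refine Finset.sum_congr rfl fun i _ => ?_
  by_cases hS : S i
  swap
  · simp [hS]
  cases hi : τ.1 i
  · rw [cre_apply, hi]
    simp only [Bool.false_eq_true, if_false, ite_self]
    refine Finset.sum_eq_zero fun σ _ => ?_
    rw [if_neg, zero_mul]
    rintro ⟨-, -, h⟩
    rw [h] at hi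
    simp at hi
  · have h1 : Function.update τ.1 i true = τ.1 := by rw [← hi, Function.update_eq_self]
    rw [Finset.sum_eq_single ⟨Function.update τ.1 i false, hOK _ _ τ.2⟩]
    · simp [hS, cre_apply, hi, h1, sgn_update, extendZero, hOK _ i τ.2]
    · intro σ _ hσ
      rw [if_neg, zero_mul]
      rintro ⟨-, h, h'⟩
      apply hσ
      ext1
      simp only [h', Function.update_idem]
      rw [← h, Function.update_eq_self]
    · simp

lemma free_congr {S : Fin N → Prop} {ψ φ : Config N → ℂ} {τ : Config N}
    (h : ∀ i, S i → τ i = true →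
      ψ (Function.update τ i false) = φ (Function.update τ i false)) :
    free S ψ τ = free S φ τ := by
  rw [free_apply_apply, free_apply_apply]
  refine Finset.sum_congr rfl fun i hi => ?_
  rw [cre_apply, cre_apply]
  split_ifs with h'
  · rw [h i (by simpa using hi) h']
  · rfl

/-- Restriction of a function on all configurations to the allowed ones. -/
def restrictOK (OK : Config N → Prop) (ψ : Config N → ℂ) : AState N OK := fun σ => ψ σ.1

lemma Qop_restrictOK {OK : Config N → Prop}
    (hOK : ∀ τ i, OK τ → OK (Function.update τ i false)) (S : Fin N → Prop)
    (ψ : Config N → ℂ) :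
    Qop N OK S (restrictOK OK ψ) = restrictOK OK (free S ψ) := by
  ext τ
  rw [Qop_apply hOK]
  exact free_congr fun i _ _ => by simp [extendZero, restrictOK, hOK _ i τ.2]

lemma restrictOK_extendZero {OK : Config N → Prop} (ψ : AState N OK) :
    restrictOK OK (extendZero ψ) = ψ := by
  ext τ
  simp [restrictOK, extendZero, τ.2]

lemma Qop_anticomm {OK : Config N → Prop}
    (hOK : ∀ τ i, OK τ → OK (Function.update τ i false)) (S T : Fin N → Prop)
    (ψ : AState N OK) :
    Qop N OK S (Qop N OK T ψ) = -Qop N OK T (Qop N OK S ψ) := by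
  rw [← restrictOK_extendZero ψ]
  simp only [Qop_restrictOK hOK]
  rw [eq_neg_of_add_eq_zero_left (free_anticomm S T (extendZero ψ))]
  rfl

lemma fermions_update_false {τ : Config N} {i : Fin N} (hi : τ i = true) :
    fermions (Function.update τ i false) + 1 = fermions τ := by
  have h : Finset.univ.filter (fun j => τ j = true) =
      insert i (Finset.univ.filter fun j => Function.update τ i false j = true) := by
    ext j
    rcases eq_or_ne j i with rfl | hj
    · simp [hi]
    · simp [hj]
  rw [fermions, fermions, h, Finset.card_insert_of_notMem (by simp)]

/-- Projection onto the states of fermion number `f`. -/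
def gradeProj {OK : Config N → Prop} (f : ℕ) (ψ : AState N OK) : AState N OK :=
  fun σ => if fermions σ.1 = f then ψ σ else 0

lemma gradeProj_mem {OK : Config N → Prop} (f : ℕ) (ψ : AState N OK) :
    gradeProj f ψ ∈ gradeV N OK f := fun σ h => by simp [gradeProj, h]

lemma gradeProj_of_mem {OK : Config N → Prop} {f : ℕ} {ψ : AState N OK}
    (h : ψ ∈ gradeV N OK f) : gradeProj f ψ = ψ := by
  ext σ
  simp only [gradeProj]
  split_ifs with h'
  · rfl
  · exact (h σ h').symm

lemma gradeProj_Qop_succ {OK : Config N → Prop}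
    (hOK : ∀ τ i, OK τ → OK (Function.update τ i false)) (S : Fin N → Prop) (f : ℕ)
    (ψ : AState N OK) :
    gradeProj (f + 1) (Qop N OK S ψ) = Qop N OK S (gradeProj f ψ) := by
  ext τ
  simp only [gradeProj, Qop_apply hOK]
  split_ifs with h
  · refine free_congr fun i _ hi => ?_
    have := fermions_update_false hi
    simp [extendZero, hOK _ i τ.2, gradeProj, show
      fermions (Function.update τ.1 i false) = f by omega]
  · rw [← Pi.zero_apply (M := fun _ => ℂ) τ.1, ← map_zero (free S)]
    refine free_congr fun i _ hi => ?_
    have := fermions_update_false hi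
    simp [extendZero, hOK _ i τ.2, gradeProj, show
      fermions (Function.update τ.1 i false) ≠ f by omega]

lemma gradeProj_Qop_zero {OK : Config N → Prop}
    (hOK : ∀ τ i, OK τ → OK (Function.update τ i false)) (S : Fin N → Prop)
    (ψ : AState N OK) :
    gradeProj 0 (Qop N OK S ψ) = 0 := by
  ext τ
  simp only [gradeProj, Qop_apply hOK]
  split_ifs with h
  · rw [free_apply_apply]
    refine Finset.sum_eq_zero fun i _ => ?_
    rw [cre_apply, if_neg]
    intro hi
    have := fermions_update_false hi
    omega
  · rfl

end Fermions

section Words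

/-- The context word: `M` sites of `L`, `n` sites of `s`, and then `R`. -/
def word (M n : ℕ) (L s R : ℕ → Bool) (t : ℕ) : Bool :=
  if t < M then L t else if t < M + n then s (t - M) else R (t - M - n)

/-- The word `w` has `ℓ + 1` consecutive occupied sites starting at `i`. -/
def Full (ℓ : ℕ) (w : ℕ → Bool) (i : ℕ) : Prop := ∀ k ≤ ℓ, w (i + k) = true

variable {ℓ M : ℕ} {L R : ℕ → Bool}

lemma Full.at {w : ℕ → Bool} {i : ℕ} (h : Full ℓ w i) {t : ℕ} (h1 : i ≤ t)
    (h2 : t ≤ i + ℓ) : w t = true := by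
  have := h (t - i) (by omega)
  rwa [Nat.add_sub_cancel' h1] at this

lemma full_of {w : ℕ → Bool} {i : ℕ} (h : ∀ t, i ≤ t → t ≤ i + ℓ → w t = true) :
    Full ℓ w i := fun k hk => h _ (by omega) (by omega)

lemma word_zero_eq {n : ℕ} {s s' : ℕ → Bool} (t : ℕ) :
    word M 0 L s' R t = if t < M then word M n L s R t else word M n L s R (t + n) := by
  unfold word
  by_cases h : t < M
  · simp [h]
  · simp only [h, if_false, show ¬ t + n < M by omega, show ¬ t + n < M + n by omega,
      show ¬ t < M + 0 by omega]
    congr 1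
    omega

lemma Full.full_short {n : ℕ} {s s' : ℕ → Bool} {i : ℕ} (h : Full ℓ (word M n L s R) i)
    (hi : i + ℓ < M ∨ M + n ≤ i) : ∃ j, Full ℓ (word M 0 L s' R) j := by
  rcases hi with hi | hi
  · refine ⟨i, full_of fun t h1 h2 => ?_⟩
    rw [word_zero_eq (n := n) (s := s), if_pos (by omega)]
    exact h.at h1 h2
  · refine ⟨i - n, full_of fun t h1 h2 => ?_⟩
    rw [word_zero_eq (n := n) (s := s), if_neg (by omega)]
    exact h.at (by omega) (by omega)

/-- If the short word is allowed, then two overlong clusters of the long word that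
avoid the last and the first site of the inserted block fill the whole block. -/
lemma block_full {s s' : ℕ → Bool} {i j : ℕ} (h : ∀ i, ¬ Full ℓ (word M 0 L s' R) i)
    (hi : Full ℓ (word M (ℓ + 2) L s R) i) (hi' : i ≤ M ∨ M + ℓ + 2 ≤ i)
    (hj : Full ℓ (word M (ℓ + 2) L s R) j) (hj' : j + ℓ < M ∨ M < j)
    {t : ℕ} (ht : t < ℓ + 2) : s t = true := by
  have hs : word M (ℓ + 2) L s R (M + t) = s t := by
    simp [word, ht]
  rw [← hs]
  by_contra hne
  have h1 : ¬ (i + ℓ < M ∨ M + (ℓ + 2) ≤ i) := fun h' =>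
    (hi.full_short (s' := s') h').elim h
  have h2 : ¬ (j + ℓ < M ∨ M + (ℓ + 2) ≤ j) := fun h' =>
    (hj.full_short (s' := s') h').elim h
  have h3 : ¬ (i ≤ M + t ∧ M + t ≤ i + ℓ) := fun h' => hne (hi.at h'.1 h'.2)
  have h4 : ¬ (j ≤ M + t ∧ M + t ≤ j + ℓ) := fun h' => hne (hj.at h'.1 h'.2)
  refine h i (full_of fun u hu1 hu2 => ?_)
  rw [word_zero_eq (n := ℓ + 2) (s := s)]
  split_ifs with hu
  · exact hi.at hu1 hu2
  · exact hj.at (by omega) (by omega)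

/-- If the short word is not allowed, some site of the inserted block is irrelevant for the
existence of overlong clusters avoiding either end of the block. -/
lemma exists_free_site {s' : ℕ → Bool} {i : ℕ} (h : Full ℓ (word M 0 L s' R) i) :
    ∃ p < ℓ + 2, ∀ s₁ s₂ : ℕ → Bool, (∀ t, t ≠ p → s₁ t = true → s₂ t = true) →
      ((∃ j, (j ≤ M ∨ M + ℓ + 2 ≤ j) ∧ Full ℓ (word M (ℓ + 2) L s₁ R) j) →
        ∃ j, (j ≤ M ∨ M + ℓ + 2 ≤ j) ∧ Full ℓ (word M (ℓ + 2) L s₂ R) j) ∧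
      ((∃ j, (j + ℓ < M ∨ M < j) ∧ Full ℓ (word M (ℓ + 2) L s₁ R) j) →
        ∃ j, (j + ℓ < M ∨ M < j) ∧ Full ℓ (word M (ℓ + 2) L s₂ R) j) := by
  have h0 := fun s t => word_zero_eq (M := M) (L := L) (R := R) (n := ℓ + 2) (s := s)
    (s' := s') t
  by_cases h1 : i + ℓ < M
  · refine ⟨0, by omega, fun s₁ s₂ _ => ?_⟩
    have : Full ℓ (word M (ℓ + 2) L s₂ R) i := full_of fun t ht1 ht2 => by
      have := h.at ht1 ht2
      rwa [h0 s₂, if_pos (by omega)] at this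
    exact ⟨fun _ => ⟨i, by omega, this⟩, fun _ => ⟨i, by omega, this⟩⟩
  by_cases h2 : M ≤ i
  · refine ⟨0, by omega, fun s₁ s₂ _ => ?_⟩
    have : Full ℓ (word M (ℓ + 2) L s₂ R) (i + (ℓ + 2)) := full_of fun t ht1 ht2 => by
      have := h.at (t := t - (ℓ + 2)) (by omega) (by omega)
      rwa [h0 s₂, if_neg (by omega), Nat.sub_add_cancel (by omega)] at this
    exact ⟨fun _ => ⟨_, by omega, this⟩, fun _ => ⟨_, by omega, this⟩⟩
  refine ⟨i + ℓ + 1 - M, by omega, fun s₁ s₂ hs => ?_⟩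
  have hw : ∀ t, t ≠ i + ℓ + 1 → word M (ℓ + 2) L s₁ R t = true →
      word M (ℓ + 2) L s₂ R t = true := by
    intro t ht
    unfold word
    split_ifs
    · exact id
    · exact hs _ (by omega)
    · exact id
  constructor <;> rintro ⟨j, hj, hj'⟩
  · by_cases hji : j ≤ i + ℓ + 1 ∧ i + ℓ + 1 ≤ j + ℓ
    · refine ⟨i, by omega, full_of fun t ht1 ht2 => ?_⟩
      by_cases ht : t < M
      · have := h.at ht1 ht2
        rwa [h0 s₂, if_pos ht] at this
      · exact hw _ (by omega) (hj'.at (by omega) (by omega))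
    · exact ⟨j, hj, full_of fun t ht1 ht2 => hw _ (by omega) (hj'.at ht1 ht2)⟩
  · by_cases hji : j ≤ i + ℓ + 1 ∧ i + ℓ + 1 ≤ j + ℓ
    · refine ⟨i + ℓ + 2, by omega, full_of fun t ht1 ht2 => ?_⟩
      by_cases ht : t < M + (ℓ + 2)
      · exact hw _ (by omega) (hj'.at (by omega) (by omega))
      · have := h.at (t := t - (ℓ + 2)) (by omega) (by omega)
        rwa [h0 s₂, if_neg (by omega), Nat.sub_add_cancel (by omega)] at this
    · exact ⟨j, hj, full_of fun t ht1 ht2 => hw _ (by omega) (hj'.at ht1 ht2)⟩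

end Words

section Splitting

/-- The part of a configuration on the last `Nt` sites. -/
def rest {ℓ Nt : ℕ} (τ : Config (Nt + (ℓ + 2))) : Config Nt := fun i => τ (i.addNat (ℓ + 2))

/-- The last site of the block `S₁`. -/
def blockEnd (ℓ Nt : ℕ) : Fin (Nt + (ℓ + 2)) := ⟨ℓ + 1, by omega⟩

/-- The first site of the block `S₁`. -/
def blockStart (ℓ Nt : ℕ) : Fin (Nt + (ℓ + 2)) := ⟨0, by omega⟩

/-- The configuration with fully occupied block `S₁` followed by `r`. -/
def fullBlock (ℓ : ℕ) {Nt : ℕ} (r : Config Nt) : Config (Nt + (ℓ + 2)) := fun i =>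
  if h : i.1 < ℓ + 2 then true
  else r ⟨i.1 - (ℓ + 2), by have h2 := i.isLt; omega⟩

/-- The exclusion rules of the long chain are the disjunction of two rules `A` and `D`,
insensitive to the last and the first site of the block `S₁` respectively; they conflict with
each other on a fully occupied block only, unless the remaining configuration is not allowed
on the short chain. -/
structure Splitting (ℓ Nt : ℕ) (OKN : Config (Nt + (ℓ + 2)) → Prop)
    (OKt : Config Nt → Prop) (A D : Config (Nt + (ℓ + 2)) → Prop) : Prop where
  okN : ∀ τ, OKN τ ↔ ¬ A τ ∧ ¬ D τ
  okt : ∀ r i, OKt r → OKt (Function.update r i false)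
  monoA : ∀ τ i, A (Function.update τ i false) → A τ
  monoD : ∀ τ i, D (Function.update τ i false) → D τ
  freeA : ∀ τ, A (Function.update τ (blockEnd ℓ Nt) true) → A τ
  freeD : ∀ τ, D (Function.update τ (blockStart ℓ Nt) true) → D τ
  headA : ∀ τ, (∀ i, i.1 ≤ ℓ → τ i = true) → A τ
  tailD : ∀ τ, (∀ i, 1 ≤ i.1 → i.1 < ℓ + 2 → τ i = true) → D τ
  full : ∀ τ, OKt (rest τ) → A τ → D τ → ∀ i, i.1 < ℓ + 2 → τ i = true
  site : ∀ r, ¬ OKt r → ∃ p : Fin (Nt + (ℓ + 2)), p.1 < ℓ + 2 ∧ ∀ τ, rest τ = r →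
    (A (Function.update τ p true) → A τ) ∧ (D (Function.update τ p true) → D τ)

variable {ℓ Nt : ℕ}

lemma rest_update {τ : Config (Nt + (ℓ + 2))} {i : Fin (Nt + (ℓ + 2))} (hi : i.1 < ℓ + 2)
    (b : Bool) : rest (Function.update τ i b) = rest τ := by
  ext j
  have : j.addNat (ℓ + 2) ≠ i := by
    intro h
    rw [← h, Fin.val_addNat] at hi
    omega
  simp [rest, this]

lemma rest_glue (r : Config Nt) : rest (glue ℓ Nt r) = r := by
  ext j
  simp [rest, glue]

lemma rest_fullBlock (r : Config Nt) : rest (fullBlock ℓ r) = r := by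
  ext j
  simp [rest, fullBlock]

lemma eq_fullBlock {τ : Config (Nt + (ℓ + 2))} (h : ∀ i, i.1 < ℓ + 2 → τ i = true) :
    τ = fullBlock ℓ (rest τ) := by
  ext i
  by_cases hi : i.1 < ℓ + 2
  · simp [fullBlock, hi, h]
  · simp only [fullBlock, hi, dif_neg, not_false_iff, rest]
    congr 1
    ext
    simp
    omega

lemma update_fullBlock (r : Config Nt) :
    Function.update (Function.update (fullBlock ℓ r) (blockEnd ℓ Nt) false)
      (blockStart ℓ Nt) false = glue ℓ Nt r := by
  ext i
  simp only [Function.update_apply, fullBlock, glue, blockStart, blockEnd, Fin.ext_iff]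
  split_ifs with h1 h2 h3 <;> simp <;> omega

/-- The amplitude of `ψ` vanishes away from the configurations `χ r`. -/
def ChiSupported (g : Config (Nt + (ℓ + 2)) → ℂ) : Prop :=
  ∀ τ, τ ≠ glue ℓ Nt (rest τ) → g τ = 0

namespace ChiSupported

variable {g : Config (Nt + (ℓ + 2)) → ℂ}

lemma cre_eq_zero (hg : ChiSupported g) {i : Fin (Nt + (ℓ + 2))} (hi : i.1 < ℓ + 2)
    (h0 : i ≠ blockStart ℓ Nt) (h1 : i ≠ blockEnd ℓ Nt) : cre i g = 0 := by
  ext τ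
  rw [cre_apply]
  split_ifs with h
  · rw [hg, mul_zero, Pi.zero_apply]
    intro heq
    have := congrFun heq i
    simp only [blockStart, blockEnd, ne_eq, Fin.ext_iff] at h0 h1
    rw [Function.update_self, glue, dif_pos hi] at this
    simp at this
    omega
  · rfl

lemma free_eq (hg : ChiSupported g) :
    free (S1 (Nt + (ℓ + 2)) ℓ) g = cre (blockStart ℓ Nt) g + cre (blockEnd ℓ Nt) g := by
  rw [free_apply]
  have hne : blockStart ℓ Nt ≠ blockEnd ℓ Nt := by simp [blockStart, blockEnd]
  rw [← Finset.sum_pair hne (f := fun i => cre i g)]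
  symm
  apply Finset.sum_subset
  · intro i hi
    simp only [Finset.mem_insert, Finset.mem_singleton] at hi
    refine Finset.mem_filter.2 ⟨Finset.mem_univ _, ?_⟩
    rcases hi with rfl | rfl <;> simp [S1, blockStart, blockEnd]
  · intro i hi hi'
    simp only [Finset.mem_insert, Finset.mem_singleton, not_or] at hi'
    exact hg.cre_eq_zero (Finset.mem_filter.1 hi).2 hi'.1 hi'.2

lemma free_cre (hg : ChiSupported g) :
    free (S1 (Nt + (ℓ + 2)) ℓ) (cre (blockStart ℓ Nt) g) =
      cre (blockEnd ℓ Nt) (cre (blockStart ℓ Nt) g) := by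
  rw [free_apply, Finset.sum_eq_single (blockEnd ℓ Nt)]
  · intro i hi hne
    by_cases h0 : i = blockStart ℓ Nt
    · rw [h0]
      exact self_eq_neg.mp (eq_neg_of_add_eq_zero_left (cre_cre_add _ _ g))
    · rw [eq_neg_of_add_eq_zero_left (cre_cre_add _ _ g),
        hg.cre_eq_zero (Finset.mem_filter.1 hi).2 h0 hne]
      simp
  · intro h
    exact absurd (Finset.mem_filter.2 ⟨Finset.mem_univ _, by simp [S1, blockEnd]⟩) h

lemma cre_cre_fullBlock (r : Config Nt) :
    cre (blockEnd ℓ Nt) (cre (blockStart ℓ Nt) g) (fullBlock ℓ r) =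
      sgn (fullBlock ℓ r) (blockEnd ℓ Nt) *
        sgn (Function.update (fullBlock ℓ r) (blockEnd ℓ Nt) false) (blockStart ℓ Nt) *
        g (glue ℓ Nt r) := by
  have hne : blockStart ℓ Nt ≠ blockEnd ℓ Nt := by simp [blockStart, blockEnd]
  rw [cre_apply, if_pos (by simp [fullBlock, blockEnd]), cre_apply,
    if_pos (by rw [Function.update_of_ne hne]; simp [fullBlock, blockStart]),
    update_fullBlock, mul_assoc]

end ChiSupported

variable {OKN : Config (Nt + (ℓ + 2)) → Prop} {OKt : Config Nt → Prop}
  {A D : Config (Nt + (ℓ + 2)) → Prop}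

namespace Splitting

lemma okN_update (hs : Splitting ℓ Nt OKN OKt A D) (τ : Config (Nt + (ℓ + 2)))
    (i : Fin (Nt + (ℓ + 2))) (h : OKN τ) : OKN (Function.update τ i false) := by
  rw [hs.okN] at h ⊢
  exact ⟨fun h' => h.1 (hs.monoA _ _ h'), fun h' => h.2 (hs.monoD _ _ h')⟩

lemma cre_start_support (hs : Splitting ℓ Nt OKN OKt A D) {g : Config (Nt + (ℓ + 2)) → ℂ}
    (hg : ChiSupported g) (τ : Config (Nt + (ℓ + 2))) (h : ¬ A τ) :
    cre (blockStart ℓ Nt) g τ = 0 := by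
  rw [cre_apply]
  split_ifs with h0
  · rw [hg, mul_zero]
    intro heq
    refine h (hs.headA _ fun i hi => ?_)
    by_cases hi0 : i = blockStart ℓ Nt
    · rw [hi0, h0]
    · have := congrFun heq i
      rw [Function.update_of_ne hi0, glue, dif_pos (by omega)] at this
      simp only [blockStart, Fin.ext_iff] at hi0
      rw [this]
      simp
      omega
  · rfl

lemma cre_end_support (hs : Splitting ℓ Nt OKN OKt A D) {g : Config (Nt + (ℓ + 2)) → ℂ}
    (hg : ChiSupported g) (τ : Config (Nt + (ℓ + 2))) (h : ¬ D τ) :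
    cre (blockEnd ℓ Nt) g τ = 0 := by
  rw [cre_apply]
  split_ifs with h0
  · rw [hg, mul_zero]
    intro heq
    refine h (hs.tailD _ fun i hi hi' => ?_)
    by_cases hi0 : i = blockEnd ℓ Nt
    · rw [hi0, h0]
    · have := congrFun heq i
      rw [Function.update_of_ne hi0, glue, dif_pos (by omega)] at this
      simp only [blockEnd, Fin.ext_iff] at hi0
      rw [this]
      simp
      omega
  · rfl

lemma free_chi (hs : Splitting ℓ Nt OKN OKt A D) {g : Config (Nt + (ℓ + 2)) → ℂ}
    (hg : ChiSupported g) (τ : Config (Nt + (ℓ + 2))) (h : OKN τ) :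
    free (S1 (Nt + (ℓ + 2)) ℓ) g τ = 0 := by
  rw [hs.okN] at h
  rw [hg.free_eq, Pi.add_apply, hs.cre_start_support hg τ h.1,
    hs.cre_end_support hg τ h.2, add_zero]

lemma okN_glue (hs : Splitting ℓ Nt OKN OKt A D) (r : Config Nt) (h : OKt r) :
    OKN (glue ℓ Nt r) := by
  rw [hs.okN]
  constructor <;> intro h'
  · have hA : A (Function.update (glue ℓ Nt r) (blockEnd ℓ Nt) true) := by
      apply hs.monoA _ (blockEnd ℓ Nt)
      rwa [Function.update_idem, Function.update_eq_self_iff.mpr]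
      simp [glue, blockEnd]
    have hD : D (Function.update (glue ℓ Nt r) (blockEnd ℓ Nt) true) := by
      refine hs.tailD _ fun i hi hi' => ?_
      by_cases h0 : i = blockEnd ℓ Nt
      · simp [h0]
      · rw [Function.update_of_ne h0]
        simp only [blockEnd, Fin.ext_iff] at h0
        simp [glue, hi', hi]
        omega
    have := hs.full _ (by rwa [rest_update (by simp [blockEnd]), rest_glue]) hA hD
      (blockStart ℓ Nt) (by simp [blockStart])
    simp [blockStart, blockEnd, glue] at this
  · have hD : D (Function.update (glue ℓ Nt r) (blockStart ℓ Nt) true) := by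
      apply hs.monoD _ (blockStart ℓ Nt)
      rwa [Function.update_idem, Function.update_eq_self_iff.mpr]
      simp [glue, blockStart]
    have hA : A (Function.update (glue ℓ Nt r) (blockStart ℓ Nt) true) := by
      refine hs.headA _ fun i hi => ?_
      by_cases h0 : i = blockStart ℓ Nt
      · simp [h0]
      · rw [Function.update_of_ne h0]
        simp only [blockStart, Fin.ext_iff] at h0
        simp [glue, hi, show i.1 < ℓ + 2 by omega]
        omega
    have := hs.full _ (by rwa [rest_update (by simp [blockStart]), rest_glue]) hA hD
      (blockEnd ℓ Nt) (by simp [blockEnd])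
    simp [blockStart, blockEnd, glue] at this

/-- A state of the form `χ ξ`, with `ξ` supported on allowed configurations, is a
coboundary of `Q₁` only if it vanishes. -/
lemma eq_zero_of_chi (hs : Splitting ℓ Nt OKN OKt A D) {g φ : Config (Nt + (ℓ + 2)) → ℂ}
    (hg : ChiSupported g) (hgN : ∀ τ, ¬ OKN τ → g τ = 0)
    (h : ∀ τ, OKN τ → free (S1 (Nt + (ℓ + 2)) ℓ) φ τ = g τ) (r : Config Nt) (hr : OKt r) :
    g (glue ℓ Nt r) = 0 := by
  set d := free (S1 (Nt + (ℓ + 2)) ℓ) with hd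
  set α : Config (Nt + (ℓ + 2)) → ℂ := fun τ => if A τ then d φ τ else 0 with hα
  have hαA : ∀ τ, ¬ A τ → α τ = 0 := fun τ hτ => by simp [hα, hτ]
  set β := d φ - g - α with hβ
  have hβD : ∀ τ, ¬ D τ → β τ = 0 := fun τ hτ => by
    by_cases hA : A τ
    · simp [hβ, hα, hA, hgN τ fun h' => ((hs.okN τ).1 h').1 hA]
    · simp [hβ, hα, hA, h τ ((hs.okN τ).2 ⟨hA, hτ⟩)]
  set κ := d α + cre (blockStart ℓ Nt) g with hκ
  have hκ' : κ = -(d β + cre (blockEnd ℓ Nt) g) := by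
    rw [hκ, hβ, map_sub, map_sub, free_free, hg.free_eq]
    abel
  have hκA : ∀ τ, ¬ A τ → κ τ = 0 := fun τ hτ => by
    rw [hκ, Pi.add_apply, free_support (fun τ i _ => hs.monoA τ i) hαA τ hτ,
      hs.cre_start_support hg τ hτ, add_zero]
  have hκD : ∀ τ, ¬ D τ → κ τ = 0 := fun τ hτ => by
    rw [hκ', Pi.neg_apply, Pi.add_apply, free_support (fun τ i _ => hs.monoD τ i) hβD τ hτ,
      hs.cre_end_support hg τ hτ, add_zero, neg_zero]
  have h0 : d κ (fullBlock ℓ r) = 0 := by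
    refine free_eq_zero fun i hi _ => ?_
    by_cases hA : A (Function.update (fullBlock ℓ r) i false)
    · by_cases hD : D (Function.update (fullBlock ℓ r) i false)
      · have := hs.full _ (by rwa [rest_update hi, rest_fullBlock]) hA hD i hi
        simp at this
      · exact hκD _ hD
    · exact hκA _ hA
  rw [hκ, map_add, free_free, zero_add, hg.free_cre, ChiSupported.cre_cre_fullBlock] at h0
  simpa [sgn_ne_zero] using h0

/-- Every cocycle of `Q₁` is cohomologous to a state of the form `χ ξ`. -/
lemma exists_chi (hs : Splitting ℓ Nt OKN OKt A D) {ψ : Config (Nt + (ℓ + 2)) → ℂ}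
    (hψ : ∀ τ, OKN τ → free (S1 (Nt + (ℓ + 2)) ℓ) ψ τ = 0) :
    ∃ g : Config (Nt + (ℓ + 2)) → ℂ, ChiSupported g ∧ (∀ τ, ¬ OKt (rest τ) → g τ = 0) ∧
      ((∀ τ, OKt (rest τ) → ψ τ = 0) → g = 0) ∧
      ∃ φ, ∀ τ, OKN τ → ψ τ - g τ = free (S1 (Nt + (ℓ + 2)) ℓ) φ τ := by
  set d := free (S1 (Nt + (ℓ + 2)) ℓ) with hd
  set α : Config (Nt + (ℓ + 2)) → ℂ := fun τ => if A τ then d ψ τ else 0 with hα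
  have hαA : ∀ τ, ¬ A τ → α τ = 0 := fun τ hτ => by simp [hα, hτ]
  set β := d ψ - α with hβ
  have hβD : ∀ τ, ¬ D τ → β τ = 0 := fun τ hτ => by
    by_cases hA : A τ
    · simp [hβ, hα, hA]
    · simp [hβ, hα, hA, hψ τ ((hs.okN τ).2 ⟨hA, hτ⟩)]
  set g : Config (Nt + (ℓ + 2)) → ℂ := fun τ =>
    if τ = glue ℓ Nt (rest τ) ∧ OKt (rest τ) then
      (sgn (fullBlock ℓ (rest τ)) (blockEnd ℓ Nt) *
        sgn (Function.update (fullBlock ℓ (rest τ)) (blockEnd ℓ Nt) false)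
          (blockStart ℓ Nt))⁻¹ * d α (fullBlock ℓ (rest τ)) else 0 with hgdef
  have hg : ChiSupported g := fun τ hτ => by simp [hgdef, hτ]
  refine ⟨g, hg, fun τ hτ => by simp [hgdef, hτ], fun h0 => ?_, ?_⟩
  · ext τ
    simp only [hgdef, Pi.zero_apply]
    split_ifs with hτ
    · have : d α (fullBlock ℓ (rest τ)) = 0 := by
        refine free_eq_zero fun i hi _ => ?_
        simp only [hα]
        split_ifs
        · refine free_eq_zero fun j hj _ => h0 _ ?_
          rw [rest_update hj, rest_update hi, rest_fullBlock]
          exact hτ.2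
        · rfl
      rw [this, mul_zero]
    · rfl
  set α' := α - cre (blockStart ℓ Nt) g with hα'
  set β' := β - cre (blockEnd ℓ Nt) g with hβ'
  have hα'A : ∀ τ, ¬ A τ → α' τ = 0 := fun τ hτ => by
    simp [hα', hαA τ hτ, hs.cre_start_support hg τ hτ]
  have hβ'D : ∀ τ, ¬ D τ → β' τ = 0 := fun τ hτ => by
    simp [hβ', hβD τ hτ, hs.cre_end_support hg τ hτ]
  have hsum : α' + β' = d ψ - d g := by
    rw [hα', hβ', hβ, hd, hg.free_eq]
    abel
  have hdsum : d α' = -d β' := by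
    rw [eq_neg_iff_add_eq_zero, ← map_add, hsum, map_sub, free_free, free_free, sub_zero]
  have hωA : ∀ τ, ¬ A τ → d α' τ = 0 :=
    free_support (fun τ i _ => hs.monoA τ i) hα'A
  have hωD : ∀ τ, ¬ D τ → d α' τ = 0 := fun τ hτ => by
    rw [hdsum, Pi.neg_apply, free_support (fun τ i _ => hs.monoD τ i) hβ'D τ hτ, neg_zero]
  have hω0 : ∀ τ, OKt (rest τ) → d α' τ = 0 := fun τ hτ => by
    by_cases hA : A τ
    · by_cases hD : D τ
      · rw [eq_fullBlock (hs.full τ hτ hA hD), hα', map_sub, hg.free_cre, Pi.sub_apply,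
          ChiSupported.cre_cre_fullBlock]
        simp only [hgdef, rest_glue, true_and, hτ, if_true]
        rw [mul_inv_cancel_left₀ (mul_ne_zero (sgn_ne_zero _ _) (sgn_ne_zero _ _)), sub_self]
      · exact hωD τ hD
    · exact hωA τ hA
  choose p hp hpA using hs.site
  set γ : Config (Nt + (ℓ + 2)) → ℂ := fun τ =>
    if h : OKt (rest τ) then 0 else ann (p (rest τ) h) (d α') τ with hγ
  have hγd : d γ = d α' := by
    ext τ
    by_cases h : OKt (rest τ)
    · rw [hω0 τ h]
      refine free_eq_zero fun i hi _ => ?_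
      simp only [hγ]
      rw [dif_pos (by rwa [rest_update hi])]
    · calc d γ τ = d (ann (p (rest τ) h) (d α')) τ := free_congr fun i hi _ => by
            simp only [hγ, rest_update hi, h, dif_neg, not_false_iff]
        _ = d α' τ := by
            rw [hd, free_ann (hp _ h) (free_free _ _)]
  have hγA : ∀ τ, ¬ A τ → γ τ = 0 := fun τ hτ => by
    simp only [hγ]
    split_ifs with h
    · rfl
    · rw [ann_apply, hωA _ fun h' => hτ ((hpA _ h τ rfl).1 h')]
      simp
  have hγD : ∀ τ, ¬ D τ → γ τ = 0 := fun τ hτ => by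
    simp only [hγ]
    split_ifs with h
    · rfl
    · rw [ann_apply, hωD _ fun h' => hτ ((hpA _ h τ rfl).2 h')]
      simp
  have h0 : S1 (Nt + (ℓ + 2)) ℓ (blockStart ℓ Nt) := by simp [S1, blockStart]
  have h1 : S1 (Nt + (ℓ + 2)) ℓ (blockEnd ℓ Nt) := by simp [S1, blockEnd]
  have hμ : d (ann (blockEnd ℓ Nt) (α' - γ)) = α' - γ :=
    free_ann h1 (by rw [map_sub, hγd, sub_self])
  have hν : d (ann (blockStart ℓ Nt) (β' + γ)) = β' + γ :=
    free_ann h0 (by rw [map_add, hγd, hdsum, add_neg_cancel])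
  set ψ' := ψ - g - ann (blockEnd ℓ Nt) (α' - γ) - ann (blockStart ℓ Nt) (β' + γ) with hψ'
  have hψ'0 : d ψ' = 0 := by
    rw [hψ', map_sub, map_sub, map_sub, hμ, hν, ← hsum]
    abel
  refine ⟨ann (blockStart ℓ Nt) ψ', fun τ hτ => ?_⟩
  rw [hs.okN] at hτ
  rw [hd, free_ann h0 hψ'0, hψ', Pi.sub_apply, Pi.sub_apply, Pi.sub_apply,
    ann_support hs.freeA (fun τ hτ => by simp [hα'A τ hτ, hγA τ hτ]) τ hτ.1,
    ann_support hs.freeD (fun τ hτ => by simp [hβ'D τ hτ, hγD τ hτ]) τ hτ.2, sub_zero, sub_zero]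

end Splitting

end Splitting

section Glue

variable {ℓ Nt : ℕ}

@[to_additive]
lemma prod_block {M : Type*} [CommMonoid M] (n m : ℕ) (f : Fin (n + m) → M) :
    ∏ i, f i = (∏ i : Fin m, f ⟨i.1, by omega⟩) * ∏ j : Fin n, f (j.addNat m) := by
  rw [← (finCongr (Nat.add_comm m n)).prod_comp, Fin.prod_univ_add]
  congr 1
  refine Finset.prod_congr rfl fun j _ => congrArg f ?_
  ext
  simp [Nat.add_comm]

lemma sgn_eq_prod {N : ℕ} (τ : Config N) (i : Fin N) :
    sgn τ i = ∏ j, if j < i ∧ τ j = true then (-1 : ℂ) else 1 := by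
  simp [sgn, Finset.prod_ite]

lemma glue_addNat (r : Config Nt) (j : Fin Nt) : glue ℓ Nt r (j.addNat (ℓ + 2)) = r j :=
  congrFun (rest_glue r) j

lemma glue_update (r : Config Nt) (j : Fin Nt) (b : Bool) :
    Function.update (glue ℓ Nt r) (j.addNat (ℓ + 2)) b = glue ℓ Nt (Function.update r j b) := by
  ext i
  by_cases hi : i.1 < ℓ + 2
  · have : i ≠ j.addNat (ℓ + 2) := by
      rintro rfl
      rw [Fin.val_addNat] at hi
      omega
    simp [this, glue, hi]
  · simp only [Function.update_apply, glue, hi, dif_neg, not_false_iff, Fin.ext_iff,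
      Fin.val_addNat]
    have : i.1 = j.1 + (ℓ + 2) ↔ i.1 - (ℓ + 2) = j.1 := by omega
    simp [this]

/-- The sign picked up by moving a particle past `χ`. -/
def chiSign (ℓ : ℕ) : ℂ := ∏ i : Fin (ℓ + 2), if 1 ≤ i.1 ∧ i.1 ≤ ℓ then -1 else 1

lemma chiSign_ne_zero (ℓ : ℕ) : chiSign ℓ ≠ 0 :=
  Finset.prod_ne_zero_iff.2 fun i _ => by split_ifs <;> simp

lemma sgn_glue (r : Config Nt) (j : Fin Nt) :
    sgn (glue ℓ Nt r) (j.addNat (ℓ + 2)) = chiSign ℓ * sgn r j := by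
  rw [sgn_eq_prod, sgn_eq_prod, prod_block, chiSign]
  congr 1
  · refine Finset.prod_congr rfl fun i _ => ?_
    have h1 : (⟨i.1, by omega⟩ : Fin (Nt + (ℓ + 2))) < j.addNat (ℓ + 2) := by
      change i.1 < j.1 + (ℓ + 2)
      omega
    simp [glue, h1]
  · refine Finset.prod_congr rfl fun i _ => ?_
    have h1 : i.addNat (ℓ + 2) < j.addNat (ℓ + 2) ↔ i < j := by
      rw [Fin.lt_def, Fin.lt_def, Fin.val_addNat, Fin.val_addNat]
      omega
    simp only [glue_addNat, h1]

lemma fermions_glue (r : Config Nt) : fermions (glue ℓ Nt r) = fermions r + ℓ := by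
  have h : ∑ i : Fin (ℓ + 2), (if 1 ≤ i.1 ∧ i.1 ≤ ℓ then 1 else 0) = ℓ := by
    rw [Fin.sum_univ_succ, Fin.sum_univ_castSucc]
    simp
  rw [fermions, fermions, Finset.card_filter, Finset.card_filter, sum_block, add_comm]
  congr 1
  · simp only [glue_addNat]
  · refine Eq.trans (Finset.sum_congr rfl fun i _ => ?_) h
    simp [glue]

variable {OKN : Config (Nt + (ℓ + 2)) → Prop} {OKt : Config Nt → Prop}
  {A D : Config (Nt + (ℓ + 2)) → Prop}

/-- The state `χ ξ` as a function on all configurations. -/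
def chi (ξ : Config Nt → ℂ) (τ : Config (Nt + (ℓ + 2))) : ℂ :=
  if τ = glue ℓ Nt (rest τ) then ξ (rest τ) else 0

lemma chiSupported_chi (ξ : Config Nt → ℂ) : ChiSupported (ℓ := ℓ) (chi ξ) :=
  fun τ h => by simp [chi, h]

lemma chi_glue (ξ : Config Nt → ℂ) (r : Config Nt) : chi ξ (glue ℓ Nt r) = ξ r := by
  simp [chi, rest_glue]

lemma ChiSupported.ext {g g' : Config (Nt + (ℓ + 2)) → ℂ} (hg : ChiSupported g)
    (hg' : ChiSupported g') (h : ∀ r, g (glue ℓ Nt r) = g' (glue ℓ Nt r)) : g = g' := by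
  ext τ
  by_cases hτ : τ = glue ℓ Nt (rest τ)
  · rw [hτ, h]
  · rw [hg τ hτ, hg' τ hτ]

lemma Gop_eq (ξ : AState Nt OKt) :
    Gop ℓ Nt OKN OKt ξ = restrictOK OKN (chi (extendZero ξ)) := by
  ext τ
  simp only [Gop, Matrix.mulVecLin_apply, Matrix.mulVec, dotProduct, Gmat, restrictOK, chi,
    ite_mul, one_mul, zero_mul]
  split_ifs with h
  · by_cases hr : OKt (rest τ.1)
    · rw [Finset.sum_eq_single ⟨rest τ.1, hr⟩]
      · simp [extendZero, hr, ← h]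
      · intro r _ hne
        rw [if_neg]
        intro h'
        apply hne
        ext1
        simp only [h', rest_glue]
      · simp
    · simp only [extendZero, hr, dif_neg, not_false_iff]
      refine Finset.sum_eq_zero fun r _ => if_neg fun h' => hr ?_
      rw [h', rest_glue]
      exact r.2
  · refine Finset.sum_eq_zero fun r _ => if_neg fun h' => h ?_
    rw [h', rest_glue]

lemma Gop_gradeProj (ξ : AState Nt OKt) (f : ℕ) :
    Gop ℓ Nt OKN OKt (gradeProj f ξ) = gradeProj (f + ℓ) (Gop ℓ Nt OKN OKt ξ) := by
  ext τ
  simp only [Gop_eq, restrictOK, gradeProj, chi]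
  by_cases h : τ.1 = glue ℓ Nt (rest τ.1)
  · have : fermions τ.1 = fermions (rest τ.1) + ℓ := by
      conv_lhs => rw [h]
      rw [fermions_glue]
    simp only [← h, if_true, this, extendZero, gradeProj, add_left_inj]
    split_ifs <;> rfl
  · simp [h]

lemma free_chi_S2 (ξ : Config Nt → ℂ) :
    free (S2 (Nt + (ℓ + 2)) ℓ) (chi ξ) = chiSign ℓ • chi (free (fun _ => True) ξ) := by
  refine ChiSupported.ext (fun τ hτ => ?_) (fun τ hτ => by simp [chi, hτ]) fun r => ?_
  · refine free_eq_zero fun i hi _ => chiSupported_chi _ _ fun heq => hτ ?_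
    have hi' : ℓ + 2 ≤ i.1 := hi
    have h1 : i = (⟨i.1 - (ℓ + 2), by omega⟩ : Fin Nt).addNat (ℓ + 2) := by
      ext
      simp
      omega
    have h2 := congrArg (fun σ => Function.update σ i (τ i)) heq
    simp only [Function.update_idem, Function.update_eq_self] at h2
    rw [h1, glue_update] at h2
    conv_rhs => rw [h2, rest_glue]
    exact h2
  · rw [Pi.smul_apply, chi_glue, free_apply_apply, free_apply_apply, Finset.sum_filter,
      Finset.sum_filter, sum_block, Finset.sum_eq_zero, zero_add, smul_eq_mul, Finset.mul_sum]
    · refine Finset.sum_congr rfl fun j _ => ?_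
      rw [if_pos (by simp [S2]), if_pos trivial, cre_apply, cre_apply, glue_addNat, sgn_glue,
        glue_update, chi_glue]
      split_ifs <;> simp [mul_assoc]
    · intro i _
      rw [if_neg]
      simp [S2]

namespace Splitting

lemma Q1_G (hs : Splitting ℓ Nt OKN OKt A D) (ξ : AState Nt OKt) :
    Qop (Nt + (ℓ + 2)) OKN (S1 (Nt + (ℓ + 2)) ℓ) (Gop ℓ Nt OKN OKt ξ) = 0 := by
  rw [Gop_eq, Qop_restrictOK hs.okN_update]
  ext τ
  exact hs.free_chi (chiSupported_chi _) τ.1 τ.2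

lemma eq_zero_of_G (hs : Splitting ℓ Nt OKN OKt A D) (ξ : AState Nt OKt)
    (h : Gop ℓ Nt OKN OKt ξ ∈
      LinearMap.range (Qop (Nt + (ℓ + 2)) OKN (S1 (Nt + (ℓ + 2)) ℓ))) : ξ = 0 := by
  obtain ⟨φ, hφ⟩ := h
  ext r
  have hN : ∀ τ, ¬ OKN τ → chi (ℓ := ℓ) (extendZero ξ) τ = 0 := fun τ hτ => by
    simp only [chi]
    split_ifs with h
    · simp only [extendZero]
      rw [dif_neg fun h' => hτ ?_]
      rw [h]
      exact hs.okN_glue _ h'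
    · rfl
  have := hs.eq_zero_of_chi (φ := extendZero φ) (chiSupported_chi _) hN (fun τ hτ => by
    rw [Gop_eq] at hφ
    rw [← Qop_apply hs.okN_update _ _ ⟨τ, hτ⟩, hφ]
    rfl) r.1 r.2
  rw [chi_glue] at this
  simpa [extendZero, r.2] using this

lemma exists_G (hs : Splitting ℓ Nt OKN OKt A D) (ψ : AState (Nt + (ℓ + 2)) OKN)
    (h : Qop (Nt + (ℓ + 2)) OKN (S1 (Nt + (ℓ + 2)) ℓ) ψ = 0) :
    ∃ (ξ : AState Nt OKt) (φ : AState (Nt + (ℓ + 2)) OKN),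
      ψ = Gop ℓ Nt OKN OKt ξ + Qop (Nt + (ℓ + 2)) OKN (S1 (Nt + (ℓ + 2)) ℓ) φ := by
  obtain ⟨g, hg, hg', -, φ, hφ⟩ := hs.exists_chi (ψ := extendZero ψ) fun τ hτ => by
    rw [← Qop_apply hs.okN_update _ _ ⟨τ, hτ⟩, h]
    rfl
  refine ⟨fun r => g (glue ℓ Nt r.1), restrictOK OKN φ, ?_⟩
  rw [Qop_restrictOK hs.okN_update, Gop_eq]
  have : chi (ℓ := ℓ) (extendZero fun r : {r // OKt r} => g (glue ℓ Nt r.1)) = g := by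
    refine (chiSupported_chi _).ext hg fun r => ?_
    rw [chi_glue]
    simp only [extendZero]
    split_ifs with hr
    · rfl
    · rw [hg' _ (by rwa [rest_glue])]
  ext τ
  have h1 := hφ τ.1 τ.2
  simp only [extendZero, τ.2, dif_pos] at h1
  simp only [this, Pi.add_apply, restrictOK, ← h1]
  ring

lemma Q2_G (hs : Splitting ℓ Nt OKN OKt A D) (ξ : AState Nt OKt) :
    ∃ φ : AState (Nt + (ℓ + 2)) OKN,
      Qop (Nt + (ℓ + 2)) OKN (S2 (Nt + (ℓ + 2)) ℓ) (Gop ℓ Nt OKN OKt ξ) =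
        chiSign ℓ • Gop ℓ Nt OKN OKt (Qop Nt OKt (fun _ => True) ξ) +
        Qop (Nt + (ℓ + 2)) OKN (S1 (Nt + (ℓ + 2)) ℓ) φ := by
  set u := free (S2 (Nt + (ℓ + 2)) ℓ) (chi (extendZero ξ)) -
    chiSign ℓ • chi (extendZero (Qop Nt OKt (fun _ => True) ξ)) with hu
  have hu' : u = chiSign ℓ • chi (free (fun _ => True) (extendZero ξ) -
      extendZero (Qop Nt OKt (fun _ => True) ξ)) := by
    rw [hu, free_chi_S2, ← smul_sub]
    congr 1
    ext τ
    simp only [chi, Pi.sub_apply]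
    split_ifs <;> simp
  have huchi : ChiSupported u := fun τ hτ => by simp [hu', chi, hτ]
  obtain ⟨g, -, -, hg0, φ, hφ⟩ := hs.exists_chi (ψ := u) fun τ hτ => hs.free_chi huchi τ hτ
  have hg : g = 0 := hg0 fun τ hτ => by
    simp only [hu', Pi.smul_apply, chi, Pi.sub_apply]
    rw [extendZero, dif_pos hτ, Qop_apply hs.okt]
    simp
  refine ⟨restrictOK OKN φ, ?_⟩
  rw [Gop_eq, Gop_eq, Qop_restrictOK hs.okN_update, Qop_restrictOK hs.okN_update]
  ext τ
  have := hφ τ.1 τ.2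
  rw [hg, Pi.zero_apply, sub_zero, hu] at this
  simp only [Pi.add_apply, Pi.smul_apply, restrictOK, ← this, Pi.sub_apply]
  ring

end Splitting

end Glue

section Contexts

variable {ℓ Nt : ℕ}

lemma extc_of_lt {N : ℕ} (σ : Config N) {t : ℕ} (h : t < N) : extc σ t = σ ⟨t, h⟩ := by
  simp [extc, h]

lemma extc_update_false {N : ℕ} {σ : Config N} {i : Fin N} {t : ℕ}
    (h : extc (Function.update σ i false) t = true) : extc σ t = true := by
  unfold extc at h ⊢
  split_ifs at h ⊢ with ht
  by_cases hi : (⟨t, ht⟩ : Fin N) = i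
  · rw [hi] at h
    simp at h
  · rwa [Function.update_of_ne hi] at h

lemma Full.mono {w w' : ℕ → Bool} {i : ℕ} (h : Full ℓ w i)
    (hw : ∀ t, w t = true → w' t = true) : Full ℓ w' i := fun k hk => hw _ (h k hk)

lemma word_mono {M n : ℕ} {L s R L' s' R' : ℕ → Bool} (hL : ∀ t, L t = true → L' t = true)
    (hs : ∀ t, s t = true → s' t = true) (hR : ∀ t, R t = true → R' t = true) (t : ℕ)
    (h : word M n L s R t = true) : word M n L' s' R' t = true := by
  unfold word at h ⊢
  split_ifs at h ⊢
  exacts [hL _ h, hs _ h, hR _ h]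

lemma rest_update_addNat (τ : Config (Nt + (ℓ + 2))) (j : Fin Nt) (b : Bool) :
    rest (Function.update τ (j.addNat (ℓ + 2)) b) = Function.update (rest τ) j b := by
  ext k
  simp [rest, Function.update_apply, Fin.ext_iff]

lemma rest_update_false {P : Config Nt → Prop} (hP : ∀ r i, P (Function.update r i false) → P r)
    (τ : Config (Nt + (ℓ + 2))) (i : Fin (Nt + (ℓ + 2)))
    (h : P (rest (Function.update τ i false))) : P (rest τ) := by
  by_cases hi : i.1 < ℓ + 2
  · rwa [rest_update hi] at h
  · have h1 : i = (⟨i.1 - (ℓ + 2), by omega⟩ : Fin Nt).addNat (ℓ + 2) := by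
      ext
      simp
      omega
    rw [h1, rest_update_addNat] at h
    exact hP _ _ h

/-- If allowed configurations are those without overlong cluster in a word surrounding the
block `S₁` by contexts depending on the other sites only, then the exclusion rules split. -/
lemma exists_splitting {OKN : Config (Nt + (ℓ + 2)) → Prop} {OKt : Config Nt → Prop} (M : ℕ)
    (L R : Config Nt → ℕ → Bool)
    (hL : ∀ r i t, L (Function.update r i false) t = true → L r t = true)
    (hR : ∀ r i t, R (Function.update r i false) t = true → R r t = true)
    (hN : ∀ τ, OKN τ ↔
      ∀ i, ¬ Full ℓ (word M (ℓ + 2) (L (rest τ)) (extc τ) (R (rest τ))) i)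
    (ht : ∀ r, OKt r ↔ ∀ i, ¬ Full ℓ (word M 0 (L r) (extc r) (R r)) i) :
    ∃ A D, Splitting ℓ Nt OKN OKt A D := by
  have hmono : ∀ (τ : Config (Nt + (ℓ + 2))) i j,
      Full ℓ (word M (ℓ + 2) (L (rest (Function.update τ i false)))
        (extc (Function.update τ i false)) (R (rest (Function.update τ i false)))) j →
      Full ℓ (word M (ℓ + 2) (L (rest τ)) (extc τ) (R (rest τ))) j := fun τ i j h =>
    h.mono (word_mono
      (fun t => rest_update_false (P := fun r => L r t = true) (fun r k => hL r k t) τ i)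
      (fun t => extc_update_false)
      (fun t => rest_update_false (P := fun r => R r t = true) (fun r k => hR r k t) τ i))
  have hupd : ∀ (τ : Config (Nt + (ℓ + 2))) (i : Fin (Nt + (ℓ + 2))) b t, t ≠ i.1 →
      extc (Function.update τ i b) t = extc τ t := fun τ i b t h => by
    unfold extc
    split_ifs with h'
    · rw [Function.update_of_ne]
      rintro rfl
      exact h rfl
    · rfl
  refine ⟨fun τ => ∃ j, (j ≤ M ∨ M + ℓ + 2 ≤ j) ∧
      Full ℓ (word M (ℓ + 2) (L (rest τ)) (extc τ) (R (rest τ))) j,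
    fun τ => ∃ j, (j + ℓ < M ∨ M < j) ∧
      Full ℓ (word M (ℓ + 2) (L (rest τ)) (extc τ) (R (rest τ))) j, ?_⟩
  constructor
  · intro τ
    rw [hN]
    constructor
    · intro h
      exact ⟨fun ⟨j, _, hj⟩ => h j hj, fun ⟨j, _, hj⟩ => h j hj⟩
    · rintro ⟨h1, h2⟩ j hj
      by_cases hjM : j ≤ M
      · exact h1 ⟨j, Or.inl hjM, hj⟩
      · exact h2 ⟨j, Or.inr (by omega), hj⟩
  · intro r i h
    rw [ht] at h ⊢
    exact fun j hj => h j (hj.mono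
      (word_mono (fun t => hL r i t) (fun t => extc_update_false) (fun t => hR r i t)))
  · rintro τ i ⟨j, hj, h⟩
    exact ⟨j, hj, hmono τ i j h⟩
  · rintro τ i ⟨j, hj, h⟩
    exact ⟨j, hj, hmono τ i j h⟩
  · rintro τ ⟨j, hj, h⟩
    refine ⟨j, hj, full_of fun t h1 h2 => ?_⟩
    have := h.at h1 h2
    rw [rest_update (by simp [blockEnd])] at this
    unfold word at this ⊢
    split_ifs at this ⊢ with h3 h4
    · exact this
    · rwa [hupd _ _ _ _ (by simp only [blockEnd]; omega)] at this
    · exact this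
  · rintro τ ⟨j, hj, h⟩
    refine ⟨j, hj, full_of fun t h1 h2 => ?_⟩
    have := h.at h1 h2
    rw [rest_update (by simp [blockStart])] at this
    unfold word at this ⊢
    split_ifs at this ⊢ with h3 h4
    · exact this
    · rwa [hupd _ _ _ _ (by simp only [blockStart]; omega)] at this
    · exact this
  · intro τ h
    refine ⟨M, Or.inl le_rfl, full_of fun t h1 h2 => ?_⟩
    rw [word, if_neg (by omega), if_pos (by omega), extc_of_lt _ (by omega)]
    exact h _ (by simp only; omega)
  · intro τ h
    refine ⟨M + 1, Or.inr (by omega), full_of fun t h1 h2 => ?_⟩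
    rw [word, if_neg (by omega), if_pos (by omega), extc_of_lt _ (by omega)]
    exact h _ (by simp only; omega) (by simp only; omega)
  · rintro τ hr ⟨i, hi, hi'⟩ ⟨j, hj, hj'⟩ k hk
    rw [ht] at hr
    rw [← extc_of_lt τ k.2]
    exact block_full hr hi' hi hj' hj hk
  · intro r hr
    rw [ht] at hr
    push Not at hr
    obtain ⟨i, hi⟩ := hr
    obtain ⟨p, hp, h⟩ := exists_free_site hi
    refine ⟨⟨p, by omega⟩, hp, ?_⟩
    rintro τ rfl
    rw [rest_update hp]
    exact h _ _ fun t htp htt => by rwa [hupd _ _ _ _ htp] at htt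

lemma perOK_iff {N K s : ℕ} (σ : Config N) (w : ℕ → Bool) (hK : N + ℓ ≤ K)
    (hs : s ≤ N)
    (hw : ∀ t (h : 0 < N), w t = if t < K then σ ⟨(t + s) % N, Nat.mod_lt _ h⟩ else false)
    (hN : 0 < N) :
    PerOK N ℓ σ ↔ ∀ i, ¬ Full ℓ w i := by
  constructor
  · intro h i hi
    obtain ⟨k, hk, hk'⟩ := h ⟨(i + s) % N, Nat.mod_lt _ hN⟩
    have := hi k hk
    rw [hw _ hN] at this
    split_ifs at this
    have h2 : cyc ⟨(i + s) % N, Nat.mod_lt _ hN⟩ k =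
        (⟨(i + k + s) % N, Nat.mod_lt _ hN⟩ : Fin N) := by
      ext
      simp only [cyc, Nat.mod_add_mod]
      congr 1
      omega
    rw [h2, this] at hk'
    simp at hk'
  · intro h i
    by_contra! hc
    refine h ((i.1 + (N - s)) % N) fun k hk => ?_
    have h1 := Nat.mod_lt (i.1 + (N - s)) hN
    rw [hw _ hN, if_pos (by omega)]
    have h2 := hc k hk
    rw [ne_eq, Bool.not_eq_false] at h2
    rw [← h2]
    congr 1
    ext
    simp only [cyc]
    rw [add_assoc, Nat.mod_add_mod, show i.1 + (N - s) + (k + s) = i.1 + k + N by omega,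
      Nat.add_mod_right]

lemma exists_splitting_per (hNt : ℓ < Nt) :
    ∃ A D, Splitting ℓ Nt (PerOK (Nt + (ℓ + 2)) ℓ) (PerOK Nt ℓ) A D := by
  refine exists_splitting Nt extc extc (fun _ _ _ => extc_update_false)
    (fun _ _ _ => extc_update_false) (fun τ => ?_) fun r => ?_
  · refine perOK_iff (K := 2 * Nt + (ℓ + 2)) (s := ℓ + 2) τ _ (by omega) (by omega)
      (fun t h => ?_) (by omega)
    have key : ∀ u (hu : u < Nt + (ℓ + 2)), (t + (ℓ + 2)) % (Nt + (ℓ + 2)) = u →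
        τ ⟨(t + (ℓ + 2)) % (Nt + (ℓ + 2)), Nat.mod_lt _ h⟩ = τ ⟨u, hu⟩ := by
      rintro u hu rfl
      rfl
    unfold word
    split_ifs with h1 h2 h3 h4 h5
    · rw [extc_of_lt _ h1, key (t + (ℓ + 2)) (by omega) (Nat.mod_eq_of_lt (by omega))]
      rfl
    · omega
    · rw [extc_of_lt _ (by omega), key (t - Nt) (by omega)]
      rw [show t + (ℓ + 2) = t - Nt + (Nt + (ℓ + 2)) by omega, Nat.add_mod_right,
        Nat.mod_eq_of_lt (by omega)]
    · omega
    · rw [extc_of_lt _ (by omega), key (t - Nt) (by omega)]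
      · simp only [rest]
        congr 1
        ext
        simp
        omega
      · rw [show t + (ℓ + 2) = t - Nt + (Nt + (ℓ + 2)) by omega, Nat.add_mod_right,
          Nat.mod_eq_of_lt (by omega)]
    · simp only [extc]
      rw [dif_neg (by omega)]
  · refine perOK_iff (K := 2 * Nt) (s := 0) r _ (by omega) (by omega)
      (fun t h => ?_) (by omega)
    have key : ∀ u (hu : u < Nt), (t + 0) % Nt = u →
        r ⟨(t + 0) % Nt, Nat.mod_lt _ h⟩ = r ⟨u, hu⟩ := by
      rintro u hu rfl
      rfl
    unfold word
    split_ifs with h1 h2 h3 h4 h5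
    · rw [extc_of_lt _ h1, key t h1 (Nat.mod_eq_of_lt h1)]
    · omega
    · omega
    · omega
    · rw [extc_of_lt _ (by omega), key (t - Nt - 0) (by omega)]
      rw [show t + 0 = t - Nt - 0 + Nt by omega, Nat.add_mod_right,
        Nat.mod_eq_of_lt (by omega)]
    · simp only [extc]
      rw [dif_neg (by omega)]

lemma openOK_iff {N c₁ cN : ℕ} (h₁ : c₁ ≤ ℓ) (hcN : cN ≤ ℓ) (hN : ℓ < N) (σ : Config N)
    (w : ℕ → Bool) (hw : ∀ t, w t = if t < ℓ then decide (c₁ ≤ t) else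
      if t < ℓ + N then extc σ (t - ℓ) else decide (t < ℓ + N + (ℓ - cN))) :
    OpenOK N ℓ c₁ cN σ ↔ ∀ i, ¬ Full ℓ w i := by
  have hmid : ∀ t, t < N → w (t + ℓ) = extc σ t := fun t ht => by
    rw [hw, if_neg (by omega), if_pos (by omega), Nat.add_sub_cancel]
  constructor
  · rintro ⟨ha, hb, hc⟩ i hi
    by_cases h1 : i < ℓ
    · have h2 := hi.at le_rfl (by omega)
      rw [hw, if_pos h1, decide_eq_true_eq] at h2
      refine hb ⟨by omega, fun k hk => ?_⟩
      rw [← hmid k (by omega)]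
      exact hi.at (by omega) (by omega)
    · by_cases h2 : i < N
      · refine ha (i - ℓ) fun k hk => ?_
        by_cases h3 : i - ℓ + k < N
        · rw [← hmid _ h3]
          exact hi.at (by omega) (by omega)
        · omega
      · have h3 := hi.at (t := i + ℓ) (by omega) le_rfl
        rw [hw, if_neg (by omega), if_neg (by omega), decide_eq_true_eq] at h3
        refine hc ⟨by omega, fun k hk => ?_⟩
        rw [← hmid _ (by omega)]
        exact hi.at (by omega) (by omega)
  · intro h
    refine ⟨fun a ha => h (a + ℓ) fun k hk => ?_, fun ⟨_, hb⟩ => h c₁ ?_,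
      fun ⟨_, hc⟩ => h (ℓ + N - 1 - cN) ?_⟩
    · have := ha k hk
      by_cases hlt : a + k < N
      · rw [show a + ℓ + k = a + k + ℓ by omega, hmid _ hlt]
        exact this
      · simp [extc, hlt] at this
    · refine full_of fun t ht1 ht2 => ?_
      by_cases htℓ : t < ℓ
      · rw [hw, if_pos htℓ]
        simpa using ht1
      · have := hb (t - ℓ) (by omega)
        rwa [← hmid _ (by omega), Nat.sub_add_cancel (by omega)] at this
    · refine full_of fun t ht1 ht2 => ?_
      by_cases htN : t < ℓ + N
      · have := hc (ℓ + N - 1 - t) (by omega)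
        rwa [← hmid _ (by omega), show N - 1 - (ℓ + N - 1 - t) + ℓ = t by omega] at this
      · rw [hw, if_neg (by omega), if_neg htN]
        simp
        omega

lemma exists_splitting_open {c₁ cN : ℕ} (hNt : ℓ < Nt) (h₁ : c₁ ≤ ℓ) (hcN : cN ≤ ℓ) :
    ∃ A D, Splitting ℓ Nt (OpenOK (Nt + (ℓ + 2)) ℓ c₁ cN) (OpenOK Nt ℓ c₁ cN) A D := by
  refine exists_splitting ℓ (fun _ t => decide (c₁ ≤ t))
    (fun r t => if t < Nt then extc r t else decide (t < Nt + (ℓ - cN))) (fun _ _ _ h => h)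
    (fun r i t h => ?_) (fun τ => ?_) fun r => ?_
  · beta_reduce at h ⊢
    split_ifs at h ⊢
    · exact extc_update_false h
    · exact h
  · refine openOK_iff h₁ hcN (by omega) τ _ fun t => ?_
    unfold word
    by_cases h1 : t < ℓ
    · simp [h1]
    by_cases h2 : t < ℓ + (ℓ + 2)
    · simp only [h1, h2, if_false, if_true]
      rw [if_pos (by omega)]
    by_cases h3 : t < ℓ + (Nt + (ℓ + 2))
    · simp only [h1, h2, h3, if_false, if_true]
      rw [if_pos (by omega), extc_of_lt _ (by omega), extc_of_lt _ (by omega)]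
      simp only [rest]
      congr 1
      ext
      simp
      omega
    · simp only [h1, h2, h3, if_false]
      rw [if_neg (by omega)]
      congr 1
      simp
      omega
  · refine openOK_iff h₁ hcN hNt r _ fun t => ?_
    unfold word
    by_cases h1 : t < ℓ
    · simp [h1]
    by_cases h3 : t < ℓ + Nt
    · simp only [h1, h3, add_zero, if_false, if_true]
      rw [if_pos (by omega), Nat.sub_zero]
    · simp only [h1, h3, add_zero, if_false]
      rw [if_neg (by omega)]
      congr 1
      simp
      omega

end Contexts

namespace Splitting

variable {ℓ Nt : ℕ} {OKN : Config (Nt + (ℓ + 2)) → Prop} {OKt : Config Nt → Prop}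
  {A D : Config (Nt + (ℓ + 2)) → Prop}

lemma Q2_Q1_mem (hs : Splitting ℓ Nt OKN OKt A D) (φ : AState (Nt + (ℓ + 2)) OKN) :
    Qop (Nt + (ℓ + 2)) OKN (S2 (Nt + (ℓ + 2)) ℓ)
        (Qop (Nt + (ℓ + 2)) OKN (S1 (Nt + (ℓ + 2)) ℓ) φ) ∈
      LinearMap.range (Qop (Nt + (ℓ + 2)) OKN (S1 (Nt + (ℓ + 2)) ℓ)) := by
  rw [Qop_anticomm hs.okN_update]
  exact neg_mem (LinearMap.mem_range_self _ _)

lemma Q2_G_mem (hs : Splitting ℓ Nt OKN OKt A D) {ξ : AState Nt OKt}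
    (h : Qop Nt OKt (fun _ => True) ξ = 0) :
    Qop (Nt + (ℓ + 2)) OKN (S2 (Nt + (ℓ + 2)) ℓ) (Gop ℓ Nt OKN OKt ξ) ∈
      LinearMap.range (Qop (Nt + (ℓ + 2)) OKN (S1 (Nt + (ℓ + 2)) ℓ)) := by
  obtain ⟨φ, hφ⟩ := hs.Q2_G ξ
  rw [hφ, h, map_zero, smul_zero, zero_add]
  exact LinearMap.mem_range_self _ _

lemma G_Q_mem (hs : Splitting ℓ Nt OKN OKt A D) (ξ : AState Nt OKt) :
    Gop ℓ Nt OKN OKt (Qop Nt OKt (fun _ => True) ξ) ∈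
      (LinearMap.ker (Qop (Nt + (ℓ + 2)) OKN (S1 (Nt + (ℓ + 2)) ℓ))).map
          (Qop (Nt + (ℓ + 2)) OKN (S2 (Nt + (ℓ + 2)) ℓ)) ⊔
        LinearMap.range (Qop (Nt + (ℓ + 2)) OKN (S1 (Nt + (ℓ + 2)) ℓ)) := by
  obtain ⟨φ, hφ⟩ := hs.Q2_G ξ
  have h : Gop ℓ Nt OKN OKt (Qop Nt OKt (fun _ => True) ξ) = (chiSign ℓ)⁻¹ •
      (Qop (Nt + (ℓ + 2)) OKN (S2 (Nt + (ℓ + 2)) ℓ) (Gop ℓ Nt OKN OKt ξ) -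
        Qop (Nt + (ℓ + 2)) OKN (S1 (Nt + (ℓ + 2)) ℓ) φ) := by
    rw [hφ, add_sub_cancel_right, inv_smul_smul₀ (chiSign_ne_zero ℓ)]
  rw [h]
  exact Submodule.smul_mem _ _ (sub_mem
    (Submodule.mem_sup_left (Submodule.mem_map_of_mem (hs.Q1_G ξ)))
    (Submodule.mem_sup_right (LinearMap.mem_range_self _ _)))

lemma G_mem_gradeV {ξ : AState Nt OKt} {f : ℕ} (h : ξ ∈ gradeV Nt OKt f) :
    Gop ℓ Nt OKN OKt ξ ∈ gradeV (Nt + (ℓ + 2)) OKN (f + ℓ) := by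
  rw [← gradeProj_of_mem h, Gop_gradeProj]
  exact gradeProj_mem _ _

lemma G_mem_K21 (hs : Splitting ℓ Nt OKN OKt A D) {ξ : AState Nt OKt} {f : ℕ}
    (h : ξ ∈ cocycles Nt OKt (fun _ => True) f) :
    Gop ℓ Nt OKN OKt ξ ∈ K21 (Nt + (ℓ + 2)) OKN ℓ (f + ℓ) :=
  ⟨⟨hs.Q1_G ξ, G_mem_gradeV h.2⟩, hs.Q2_G_mem h.1⟩

lemma mem_gradeV_of_G (hs : Splitting ℓ Nt OKN OKt A D) {ξ : AState Nt OKt} {f : ℕ}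
    {ψ φ : AState (Nt + (ℓ + 2)) OKN} (hψ : ψ ∈ gradeV (Nt + (ℓ + 2)) OKN (f + ℓ))
    (h : ψ = Gop ℓ Nt OKN OKt ξ + Qop (Nt + (ℓ + 2)) OKN (S1 (Nt + (ℓ + 2)) ℓ) φ) :
    ξ ∈ gradeV Nt OKt f := by
  have hadd : ∀ a b : AState (Nt + (ℓ + 2)) OKN,
      gradeProj (f + ℓ) (a + b) = gradeProj (f + ℓ) a + gradeProj (f + ℓ) b := fun a b => by
    ext τ
    simp only [gradeProj, Pi.add_apply]
    split_ifs <;> simp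
  have hproj : gradeProj (f + ℓ) (Qop (Nt + (ℓ + 2)) OKN (S1 (Nt + (ℓ + 2)) ℓ) φ) ∈
      LinearMap.range (Qop (Nt + (ℓ + 2)) OKN (S1 (Nt + (ℓ + 2)) ℓ)) := by
    rcases Nat.eq_zero_or_pos (f + ℓ) with h0 | h0
    · rw [h0, gradeProj_Qop_zero hs.okN_update]
      exact zero_mem _
    · rw [← Nat.sub_add_cancel h0, gradeProj_Qop_succ hs.okN_update]
      exact LinearMap.mem_range_self _ _
  have h2 : Gop ℓ Nt OKN OKt (gradeProj f ξ - ξ) =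
      Qop (Nt + (ℓ + 2)) OKN (S1 (Nt + (ℓ + 2)) ℓ) φ -
        gradeProj (f + ℓ) (Qop (Nt + (ℓ + 2)) OKN (S1 (Nt + (ℓ + 2)) ℓ) φ) := by
    have h3 := gradeProj_of_mem hψ
    rw [h, hadd] at h3
    rw [map_sub, Gop_gradeProj, sub_eq_sub_iff_add_eq_add, h3]
    exact add_comm _ _
  have h3 : gradeProj f ξ - ξ = 0 := hs.eq_zero_of_G _ (by
    rw [h2]
    exact sub_mem (LinearMap.mem_range_self _ _) hproj)
  rw [← sub_eq_zero.1 h3]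
  exact gradeProj_mem _ _

lemma mem_cobounds_of_G (hs : Splitting ℓ Nt OKN OKt A D) {ξ : AState Nt OKt} {f : ℕ}
    (hξ : ξ ∈ gradeV Nt OKt f)
    (h : Gop ℓ Nt OKN OKt ξ ∈ B21 (Nt + (ℓ + 2)) OKN ℓ (f + ℓ)) :
    ξ ∈ cobounds Nt OKt (fun _ => True) f := by
  obtain ⟨x, ⟨α, hα, rfl⟩, y, ⟨β, rfl⟩, hxy⟩ := Submodule.mem_sup.1 h.1
  obtain ⟨ζ, φ, rfl⟩ := hs.exists_G α hα
  obtain ⟨φ', hφ'⟩ := hs.Q2_G ζ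
  have h1 : ξ - Qop Nt OKt (fun _ => True) (chiSign ℓ • ζ) = 0 := by
    apply hs.eq_zero_of_G
    rw [map_sub, ← hxy, map_smul, map_smul, map_add, hφ', add_sub_right_comm,
      add_sub_right_comm, add_sub_cancel_left]
    exact add_mem (add_mem (LinearMap.mem_range_self _ _) (hs.Q2_Q1_mem φ))
      (LinearMap.mem_range_self _ _)
  rw [sub_eq_zero] at h1
  rw [← gradeProj_of_mem hξ, h1]
  cases f with
  | zero =>
    rw [gradeProj_Qop_zero hs.okt]
    exact zero_mem _
  | succ f =>
    rw [gradeProj_Qop_succ hs.okt]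
    exact Submodule.mem_map_of_mem (gradeProj_mem _ _)

lemma exists_equiv (hs : Splitting ℓ Nt OKN OKt A D) (f : ℕ) :
    ∃ e : CohSpace Nt OKt (fun _ => True) f ≃ₗ[ℂ] H21 (Nt + (ℓ + 2)) OKN ℓ (f + ℓ),
      ∀ (ψ' : AState Nt OKt) (h1 : ψ' ∈ cocycles Nt OKt (fun _ => True) f),
        ∃ h2 : Gop ℓ Nt OKN OKt ψ' ∈ K21 (Nt + (ℓ + 2)) OKN ℓ (f + ℓ),
          e (cohClass Nt OKt (fun _ => True) f ψ' h1) =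
            h21Class (Nt + (ℓ + 2)) OKN ℓ (f + ℓ) (Gop ℓ Nt OKN OKt ψ') h2 := by
  let G := (Gop ℓ Nt OKN OKt).restrict (p := cocycles Nt OKt (fun _ => True) f)
    (q := K21 (Nt + (ℓ + 2)) OKN ℓ (f + ℓ)) fun _ h => hs.G_mem_K21 h
  have hle : (cobounds Nt OKt (fun _ => True) f).comap
      (cocycles Nt OKt (fun _ => True) f).subtype ≤
      ((B21 (Nt + (ℓ + 2)) OKN ℓ (f + ℓ)).comap
        (K21 (Nt + (ℓ + 2)) OKN ℓ (f + ℓ)).subtype).comap G := by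
    rintro ⟨ψ, hψ⟩ ⟨φ, -, hφ⟩
    refine ⟨?_, G_mem_gradeV hψ.2⟩
    have hφ' : Qop Nt OKt (fun _ => True) φ = ψ := hφ
    subst hφ'
    exact hs.G_Q_mem φ
  let E := Submodule.mapQ _ _ G hle
  have hE : Function.Bijective E := by
    constructor
    · rw [← LinearMap.ker_eq_bot, LinearMap.ker_eq_bot']
      intro x hx
      obtain ⟨⟨ψ, hψ⟩, rfl⟩ := Submodule.Quotient.mk_surjective _ x
      rw [Submodule.mapQ_apply, Submodule.Quotient.mk_eq_zero] at hx
      rw [Submodule.Quotient.mk_eq_zero]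
      exact hs.mem_cobounds_of_G hψ.2 hx
    · intro y
      obtain ⟨⟨ψ, ⟨hψ1, hψf⟩, hψ2⟩, rfl⟩ := Submodule.Quotient.mk_surjective _ y
      obtain ⟨ξ, φ, hξ⟩ := hs.exists_G ψ hψ1
      have hξf := hs.mem_gradeV_of_G hψf hξ
      have hξ0 : Qop Nt OKt (fun _ => True) ξ = 0 := by
        apply hs.eq_zero_of_G
        obtain ⟨φ', hφ'⟩ := hs.Q2_G ξ
        have h1 : Gop ℓ Nt OKN OKt (Qop Nt OKt (fun _ => True) ξ) = (chiSign ℓ)⁻¹ •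
            (Qop (Nt + (ℓ + 2)) OKN (S2 (Nt + (ℓ + 2)) ℓ) ψ -
              Qop (Nt + (ℓ + 2)) OKN (S2 (Nt + (ℓ + 2)) ℓ)
                (Qop (Nt + (ℓ + 2)) OKN (S1 (Nt + (ℓ + 2)) ℓ) φ) -
              Qop (Nt + (ℓ + 2)) OKN (S1 (Nt + (ℓ + 2)) ℓ) φ') := by
          rw [hξ, map_add, add_sub_cancel_right, hφ', add_sub_cancel_right,
            inv_smul_smul₀ (chiSign_ne_zero ℓ)]
        rw [h1]
        exact Submodule.smul_mem _ _ (sub_mem (sub_mem hψ2 (hs.Q2_Q1_mem φ))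
          (LinearMap.mem_range_self _ _))
      refine ⟨Submodule.Quotient.mk ⟨ξ, hξ0, hξf⟩, ?_⟩
      rw [Submodule.mapQ_apply, Submodule.Quotient.eq]
      refine ⟨Submodule.mem_sup_right ⟨-φ, ?_⟩, sub_mem (G_mem_gradeV hξf) hψf⟩
      change _ = Gop ℓ Nt OKN OKt ξ - ψ
      rw [hξ, map_neg, sub_add_cancel_left]
  exact ⟨LinearEquiv.ofBijective E hE, fun ψ' h1 => ⟨hs.G_mem_K21 h1, rfl⟩⟩

end Splitting

/-- The map `G♯` is well defined and is an isomorphism: for a chain of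
`N = Ñ + (ℓ+2) > 2ℓ+2` sites with periodic or special boundary conditions,
`G` sends `Q̃`-cocycles to cocycles and `Q̃`-coboundaries to coboundaries of the
two-step complex, and the induced map identifies `H_{Q̃}^f(V_Ñ)` with `H₂₁^{f+ℓ}`
for every `f`. -/
theorem Gsharp_well_defined_and_iso (ℓ Nt : ℕ) (hℓ : 1 ≤ ℓ) (hNt : ℓ < Nt)
    (OKN : Config (Nt + (ℓ + 2)) → Prop) (OKt : Config Nt → Prop)
    (hBC : (OKN = PerOK (Nt + (ℓ + 2)) ℓ ∧ OKt = PerOK Nt ℓ) ∨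
      ∃ c₁ cN, c₁ ≤ ℓ ∧ cN ≤ ℓ ∧
        OKN = OpenOK (Nt + (ℓ + 2)) ℓ c₁ cN ∧ OKt = OpenOK Nt ℓ c₁ cN) :
    (∀ ψ' : AState Nt OKt, Qop Nt OKt (fun _ => True) ψ' = 0 →
      Qop (Nt + (ℓ + 2)) OKN (S1 (Nt + (ℓ + 2)) ℓ) (Gop ℓ Nt OKN OKt ψ') = 0 ∧
      ∃ φ, Qop (Nt + (ℓ + 2)) OKN (S2 (Nt + (ℓ + 2)) ℓ) (Gop ℓ Nt OKN OKt ψ') =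
        Qop (Nt + (ℓ + 2)) OKN (S1 (Nt + (ℓ + 2)) ℓ) φ) ∧
    (∀ ψ'' : AState Nt OKt,
      Gop ℓ Nt OKN OKt (Qop Nt OKt (fun _ => True) ψ'') ∈
        (LinearMap.ker (Qop (Nt + (ℓ + 2)) OKN (S1 (Nt + (ℓ + 2)) ℓ))).map
            (Qop (Nt + (ℓ + 2)) OKN (S2 (Nt + (ℓ + 2)) ℓ)) ⊔
          LinearMap.range (Qop (Nt + (ℓ + 2)) OKN (S1 (Nt + (ℓ + 2)) ℓ))) ∧
    (∀ f, ∃ e : CohSpace Nt OKt (fun _ => True) f ≃ₗ[ℂ]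
        H21 (Nt + (ℓ + 2)) OKN ℓ (f + ℓ),
      ∀ (ψ' : AState Nt OKt) (h1 : ψ' ∈ cocycles Nt OKt (fun _ => True) f),
        ∃ h2 : Gop ℓ Nt OKN OKt ψ' ∈ K21 (Nt + (ℓ + 2)) OKN ℓ (f + ℓ),
          e (cohClass Nt OKt (fun _ => True) f ψ' h1) =
            h21Class (Nt + (ℓ + 2)) OKN ℓ (f + ℓ) (Gop ℓ Nt OKN OKt ψ') h2) := by
  obtain ⟨A, D, hs⟩ : ∃ A D, Splitting ℓ Nt OKN OKt A D := by
    rcases hBC with ⟨rfl, rfl⟩ | ⟨c₁, cN, h₁, hcN, rfl, rfl⟩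
    · exact exists_splitting_per hNt
    · exact exists_splitting_open hNt h₁ hcN
  refine ⟨fun ψ' h => ⟨hs.Q1_G ψ', ?_⟩, hs.G_Q_mem, hs.exists_equiv⟩
  obtain ⟨φ, hφ⟩ := hs.Q2_G_mem h
  exact ⟨φ, hφ.symm⟩

end
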